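/- arXiv:1812.11451 — 2 statements merged into one kernel-verified Lean document; each statement's English description precedes it below -/
import Mathlib

section
/- Let N ≥ 3 and 2* = 2N/(N−2). Suppose (u_n) is a sequence of smooth compactly supported functions ℝ^N → ℝ with sup_n ∫_{ℝ^N} |∇u_n|² dx < ∞, and suppose that for some r > 0 one has lim_{n→∞} sup_{y ∈ ℝ^N} ∫_{B(y,r)} |u_n|² dx = 0. Then for every continuous function Ψ : ℝ → [0,∞) satisfying lim_{s→0} Ψ(s)/|s|^{2*} = 0 and lim_{|s|→∞} Ψ(s)/|s|^{2*} = 0 one has ∫_{ℝ^N} Ψ(u_n(x)) dx → 0 as n → ∞. -/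
open MeasureTheory Filter Topology

open Module
open scoped ENNReal NNReal

/-- A local-to-global form of the Gagliardo-Nirenberg-Sobolev inequality for compactly
supported functions with uniformly small `W^{1,1}` norm on balls of a fixed radius. -/
theorem exists_lintegral_rpow_le_of_setLIntegral_ball_le
    {E : Type*} [NormedAddCommGroup E] [NormedSpace ℝ E] [FiniteDimensional ℝ E]
    [MeasurableSpace E] [BorelSpace E] (μ : Measure E) [μ.IsAddHaarMeasure]
    {p : ℝ} (hp : Real.HolderConjugate (finrank ℝ E) p) {r : ℝ} (hr : 0 < r) :
    ∃ C : ℝ≥0∞, C ≠ ∞ ∧ ∀ f : E → ℝ, ContDiff ℝ 1 f → HasCompactSupport f → ∀ η : ℝ≥0∞, η ≠ ∞ →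
      (∀ y, ∫⁻ x in Metric.ball y r, (‖f x‖ₑ + ‖fderiv ℝ f x‖ₑ) ∂μ ≤ η) →
      ∫⁻ x, ‖f x‖ₑ ^ p ∂μ ≤ C * η ^ (p - 1) * ∫⁻ x, (‖f x‖ₑ + ‖fderiv ℝ f x‖ₑ) ∂μ := by
  have hp1 : 1 < p := hp.symm.lt
  have hp0 : 0 < p := hp.symm.pos
  let φ : ContDiffBump (0 : E) := ⟨r / 2, r, by positivity, by linarith⟩
  have hφ : ContDiff ℝ 1 φ := φ.contDiff
  obtain ⟨L, hL⟩ := (hφ.continuous_fderiv one_ne_zero).bounded_above_of_compact_support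
    (φ.hasCompactSupport.fderiv ℝ)
  set c : ℝ≥0∞ := ∫⁻ y, ‖φ y‖ₑ ^ p ∂μ with hc
  have hφm : Continuous φ := hφ.continuous
  have hφm' : Measurable φ := hφm.measurable
  have hφ0 {z : E} (hz : z ∉ Metric.ball (0 : E) r) : φ z = 0 := by
    rw [← φ.support_eq] at hz
    exact Function.notMem_support.1 hz
  have hφ1 (z : E) : ‖φ z‖ₑ ≤ 1 := by
    rw [← enorm_one (G := ℝ), enorm_le_iff_norm_le, Real.norm_of_nonneg φ.nonneg, norm_one]
    exact φ.le_one
  have hc0 : c ≠ 0 := by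
    rw [hc, ← pos_iff_ne_zero, lintegral_pos_iff_support (by fun_prop)]
    have : Function.support (fun y ↦ ‖φ y‖ₑ ^ p) = Metric.ball 0 r := by
      rw [← φ.support_eq]
      ext y
      simp [hp0, ENNReal.rpow_eq_zero_iff]
    rw [this]
    exact Metric.measure_ball_pos μ _ hr
  have hball0 : μ (Metric.ball (0 : E) r) ≠ ∞ := measure_ball_lt_top.ne
  have hct : c ≠ ∞ := by
    refine ne_top_of_le_ne_top hball0 ?_
    rw [hc, ← lintegral_indicator_one measurableSet_ball]
    refine lintegral_mono fun z ↦ ?_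
    by_cases hz : z ∈ Metric.ball (0 : E) r
    · rw [Set.indicator_of_mem hz]
      exact ENNReal.rpow_le_one (hφ1 z) hp0.le
    · simp [hφ0 hz, hp0]
  set S := lintegralPowLePowLIntegralFDerivConst μ p
  set D : ℝ≥0∞ := (S : ℝ≥0∞) * (1 + ENNReal.ofReal L) ^ p * μ (Metric.ball 0 r) with hD
  have hDt : D ≠ ∞ := by finiteness
  refine ⟨c⁻¹ * D, by finiteness, fun f hf hfc η hηt hη ↦ ?_⟩
  have hfm : Continuous f := hf.continuous
  have hfm' : Continuous (fderiv ℝ f) := hf.continuous_fderiv one_ne_zero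
  set h : E → ℝ≥0∞ := fun x ↦ ‖f x‖ₑ + ‖fderiv ℝ f x‖ₑ with hh
  have hhm : Measurable h := by fun_prop
  have hball : ∀ x y : E, x ∈ Metric.ball y r ↔ x - y ∈ Metric.ball (0 : E) r := by
    intro x y; simp [dist_eq_norm]
  have hloc : ∀ y, ∫⁻ x, ‖φ (x - y)‖ₑ ^ p * ‖f x‖ₑ ^ p ∂μ ≤
      S * (1 + ENNReal.ofReal L) ^ p * η ^ (p - 1) * ∫⁻ x in Metric.ball y r, h x ∂μ := by
    intro y
    have hg : ContDiff ℝ 1 (fun x ↦ φ (x - y) * f x) :=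
      (hφ.comp (contDiff_id.sub contDiff_const)).mul hf
    have key := lintegral_pow_le_pow_lintegral_fderiv μ hg hfc.mul_left hp
    have hder : ∀ x, ‖fderiv ℝ (fun x ↦ φ (x - y) * f x) x‖ₑ ≤
        (Metric.ball y r).indicator (fun x ↦ (1 + ENNReal.ofReal L) * h x) x := by
      intro x
      have hd1 : DifferentiableAt ℝ (fun x ↦ φ (x - y)) x :=
        (hφ.comp (contDiff_id.sub contDiff_const)).differentiable one_ne_zero x
      have hd2 : DifferentiableAt ℝ f x := hf.differentiable one_ne_zero x
      rw [fderiv_fun_mul hd1 hd2, fderiv_comp_sub]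
      by_cases hx : x ∈ Metric.ball y r
      · rw [Set.indicator_of_mem hx]
        have e1 := hφ1 (x - y)
        have e2 : ‖fderiv ℝ φ (x - y)‖ₑ ≤ ENNReal.ofReal L := by
          rw [← ofReal_norm]
          exact ENNReal.ofReal_le_ofReal (hL _)
        calc ‖φ (x - y) • fderiv ℝ f x + f x • fderiv ℝ φ (x - y)‖ₑ
            ≤ ‖φ (x - y) • fderiv ℝ f x‖ₑ + ‖f x • fderiv ℝ φ (x - y)‖ₑ := by
              simp only [enorm_eq_nnnorm]
              exact_mod_cast nnnorm_add_le _ _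
          _ = ‖φ (x - y)‖ₑ * ‖fderiv ℝ f x‖ₑ + ‖f x‖ₑ * ‖fderiv ℝ φ (x - y)‖ₑ := by
            rw [enorm_smul, enorm_smul]
          _ ≤ 1 * (‖f x‖ₑ + ‖fderiv ℝ f x‖ₑ) +
              (‖f x‖ₑ + ‖fderiv ℝ f x‖ₑ) * ENNReal.ofReal L := by
            gcongr
            · exact le_add_self
            · exact le_self_add
          _ = _ := by rw [hh]; ring
      · have hz : φ (x - y) = 0 := hφ0 fun h ↦ hx ((hball x y).2 h)
        have hz' : fderiv ℝ φ (x - y) = 0 :=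
          IsLocalMin.fderiv_eq_zero (Eventually.of_forall fun z ↦ hz ▸ φ.nonneg)
        rw [hz, hz', zero_smul, smul_zero, add_zero, show ‖(0 : E →L[ℝ] ℝ)‖ₑ = 0 by
          simp [enorm_eq_nnnorm]]
        exact zero_le
    calc ∫⁻ x, ‖φ (x - y)‖ₑ ^ p * ‖f x‖ₑ ^ p ∂μ
        = ∫⁻ x, ‖φ (x - y) * f x‖ₑ ^ p ∂μ := by
          simp_rw [enorm_mul, ENNReal.mul_rpow_of_nonneg _ _ hp0.le]
      _ ≤ S * (∫⁻ x, ‖fderiv ℝ (fun x ↦ φ (x - y) * f x) x‖ₑ ∂μ) ^ p := key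
      _ ≤ S * ((1 + ENNReal.ofReal L) * ∫⁻ x in Metric.ball y r, h x ∂μ) ^ p := by
          gcongr
          rw [← lintegral_const_mul _ hhm, ← lintegral_indicator measurableSet_ball]
          exact lintegral_mono hder
      _ = S * (1 + ENNReal.ofReal L) ^ p * ((∫⁻ x in Metric.ball y r, h x ∂μ) ^ (p - 1) *
            ∫⁻ x in Metric.ball y r, h x ∂μ) := by
          rw [ENNReal.mul_rpow_of_nonneg _ _ hp0.le, mul_assoc]
          congr 2
          conv_rhs => rw [← ENNReal.rpow_one (∫⁻ x in Metric.ball y r, h x ∂μ), ← ENNReal.rpow_mul,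
            one_mul, ← ENNReal.rpow_add_of_nonneg _ _ (by linarith) zero_le_one]
          congr 1; ring
      _ ≤ S * (1 + ENNReal.ofReal L) ^ p * (η ^ (p - 1) * ∫⁻ x in Metric.ball y r, h x ∂μ) := by
          gcongr
          exact hη y
      _ = _ := by ring
  have hleft : ∫⁻ y, ∫⁻ x, ‖φ (x - y)‖ₑ ^ p * ‖f x‖ₑ ^ p ∂μ ∂μ = c * ∫⁻ x, ‖f x‖ₑ ^ p ∂μ := by
    rw [lintegral_lintegral_swap (by fun_prop), ← lintegral_const_mul _ (by fun_prop)]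
    refine lintegral_congr fun x ↦ ?_
    rw [lintegral_mul_const _ (by fun_prop),
      lintegral_sub_left_eq_self (fun z ↦ ‖φ z‖ₑ ^ p) x]
  have hright : ∫⁻ y, ∫⁻ x in Metric.ball y r, h x ∂μ ∂μ =
      μ (Metric.ball 0 r) * ∫⁻ x, h x ∂μ := by
    have : ∀ y, ∫⁻ x in Metric.ball y r, h x ∂μ =
        ∫⁻ x, (Metric.ball (0 : E) r).indicator 1 (x - y) * h x ∂μ := by
      intro y
      rw [← lintegral_indicator measurableSet_ball]
      refine lintegral_congr fun x ↦ ?_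
      by_cases hx : x ∈ Metric.ball y r
      · rw [Set.indicator_of_mem hx, Set.indicator_of_mem ((hball x y).1 hx)]; simp
      · rw [Set.indicator_of_notMem hx, Set.indicator_of_notMem (fun h ↦ hx ((hball x y).2 h))]
        simp
    have hm : Measurable ((Metric.ball (0 : E) r).indicator (1 : E → ℝ≥0∞)) :=
      measurable_one.indicator measurableSet_ball
    simp_rw [this]
    rw [lintegral_lintegral_swap (by fun_prop), ← lintegral_const_mul _ (by fun_prop)]
    refine lintegral_congr fun x ↦ ?_
    rw [lintegral_mul_const _ (by fun_prop),
      lintegral_sub_left_eq_self ((Metric.ball (0 : E) r).indicator (1 : E → ℝ≥0∞)) x,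
      lintegral_indicator_one measurableSet_ball]
  have hmain : c * ∫⁻ x, ‖f x‖ₑ ^ p ∂μ ≤ D * η ^ (p - 1) * ∫⁻ x, h x ∂μ := by
    rw [← hleft]
    refine (lintegral_mono hloc).trans ?_
    rw [lintegral_const_mul' _ _ (by have := sub_nonneg.2 hp1.le; finiteness), hright, hD]
    apply le_of_eq
    ring
  calc ∫⁻ x, ‖f x‖ₑ ^ p ∂μ = c⁻¹ * (c * ∫⁻ x, ‖f x‖ₑ ^ p ∂μ) := by
        rw [← mul_assoc, ENNReal.inv_mul_cancel hc0 hct, one_mul]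
    _ ≤ c⁻¹ * (D * η ^ (p - 1) * ∫⁻ x, h x ∂μ) := by gcongr
    _ = _ := by ring

/-- There is a smooth truncation vanishing on `[-a/2, a/2]` and equal to `1` off `(-a, a)`. -/
theorem exists_contDiff_truncation {a : ℝ} (ha : 0 < a) :
    ∃ (G : ℝ → ℝ) (M : ℝ), ContDiff ℝ 1 G ∧ (∀ s, a ≤ |s| → G s = 1) ∧ (∀ s, ‖G s‖ ≤ 1) ∧
      (∀ s, ‖deriv G s‖ ≤ M) ∧ ∀ s, |s| ≤ a / 2 → G s = 0 ∧ deriv G s = 0 := by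
  let φ : ContDiffBump (0 : ℝ) := ⟨a / 2, a, by positivity, by linarith⟩
  have hφ : ContDiff ℝ 1 φ := φ.contDiff
  obtain ⟨M, hM⟩ := (hφ.continuous_deriv le_rfl).bounded_above_of_compact_support
    φ.hasCompactSupport.deriv
  have hd (s : ℝ) : deriv (fun s ↦ 1 - φ s) s = - deriv φ s := by
    rw [deriv_const_sub]
  refine ⟨fun s ↦ 1 - φ s, M, contDiff_const.sub hφ, fun s hs ↦ ?_, fun s ↦ ?_, fun s ↦ ?_,
    fun s hs ↦ ?_⟩
  · have : s ∉ Function.support φ := by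
      rw [φ.support_eq]
      simpa using hs
    simp [Function.notMem_support.1 this]
  · rw [Real.norm_of_nonneg (sub_nonneg.2 φ.le_one)]
    linarith [φ.nonneg' s]
  · rw [hd, norm_neg]
    exact hM s
  · have h1 : φ s = 1 := φ.one_of_mem_closedBall (by simpa using hs)
    refine ⟨by simp [h1], ?_⟩
    rw [hd, neg_eq_zero]
    exact IsLocalMax.deriv_eq_zero (Eventually.of_forall fun z ↦ h1 ▸ φ.le_one)

/-- Functions with bounded `L²` gradient norm and bounded `L^q` norm that vanish locally uniformly
in `L²` converge to zero in measure. -/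
theorem tendsto_measure_le_abs_of_setLIntegral_ball_tendsto_zero
    {E : Type*} [NormedAddCommGroup E] [NormedSpace ℝ E] [FiniteDimensional ℝ E]
    [MeasurableSpace E] [BorelSpace E] (μ : Measure E) [μ.IsAddHaarMeasure]
    (hE : 1 < finrank ℝ E) {u : ℕ → E → ℝ} (hu : ∀ n, ContDiff ℝ 1 (u n))
    (hus : ∀ n, HasCompactSupport (u n)) {K S : ℝ≥0∞} (hK : K ≠ ∞) (hS : S ≠ ∞)
    (huK : ∀ n, ∫⁻ x, ‖fderiv ℝ (u n) x‖ₑ ^ (2 : ℝ) ∂μ ≤ K) {q : ℝ} (hq : 0 < q)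
    (huS : ∀ n, ∫⁻ x, ‖u n x‖ₑ ^ q ∂μ ≤ S) {r : ℝ} (hr : 0 < r) {δ : ℕ → ℝ≥0∞}
    (hδ : Tendsto δ atTop (𝓝 0))
    (huδ : ∀ n y, ∫⁻ x in Metric.ball y r, ‖u n x‖ₑ ^ (2 : ℝ) ∂μ ≤ δ n) {a : ℝ} (ha : 0 < a) :
    Tendsto (fun n ↦ μ {x | a ≤ |u n x|}) atTop (𝓝 0) := by
  have hp := Real.HolderConjugate.conjExponent (p := finrank ℝ E) (mod_cast hE)
  set p := Real.conjExponent (finrank ℝ E)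
  obtain ⟨C, hC, hCf⟩ := exists_lintegral_rpow_le_of_setLIntegral_ball_le μ hp hr
  obtain ⟨G, M, hG, hG1, hGle, hGM, hG0⟩ := exists_contDiff_truncation ha
  set κ : ℝ≥0∞ := ENNReal.ofReal (2 / a) with hκ
  set M' : ℝ≥0∞ := ENNReal.ofReal M
  have hA : ∀ n x, ‖G (u n x)‖ₑ + ‖fderiv ℝ (fun x ↦ G (u n x)) x‖ₑ ≤
      {x | a / 2 < |u n x|}.indicator 1 x +
        M' * ({x | a / 2 < |u n x|}.indicator 1 x * ‖fderiv ℝ (u n) x‖ₑ) := by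
    intro n x
    have hd : fderiv ℝ (fun x ↦ G (u n x)) x = deriv G (u n x) • fderiv ℝ (u n) x :=
      ((hG.differentiable one_ne_zero _).hasDerivAt.comp_hasFDerivAt x
        ((hu n).differentiable one_ne_zero x).hasFDerivAt).fderiv
    rw [hd, enorm_smul]
    by_cases hx : a / 2 < |u n x|
    · rw [Set.indicator_of_mem (show x ∈ {x | a / 2 < |u n x|} from hx), Pi.one_apply, one_mul]
      gcongr
      · rw [← ofReal_norm]
        exact ENNReal.ofReal_le_one.2 (hGle _)
      · rw [← ofReal_norm]
        exact ENNReal.ofReal_le_ofReal (hGM _)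
    · obtain ⟨h1, h2⟩ := hG0 _ (not_lt.1 hx)
      simp [h1, h2]
  have hAm (n : ℕ) : MeasurableSet {x | a / 2 < |u n x|} :=
    measurableSet_lt measurable_const (hu n).continuous.measurable.abs
  have hcheb : ∀ (ν : Measure E) (n : ℕ) (s : ℝ), 0 < s →
      ν {x | a / 2 < |u n x|} ≤ κ ^ s * ∫⁻ x, ‖u n x‖ₑ ^ s ∂ν := by
    intro ν n s hs
    have hum := (hu n).continuous
    rw [← lintegral_indicator_one (hAm n), ← lintegral_const_mul _ (by fun_prop)]
    refine lintegral_mono fun x ↦ ?_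
    by_cases hx : a / 2 < |u n x|
    · rw [Set.indicator_of_mem (show x ∈ {x | a / 2 < |u n x|} from hx), Pi.one_apply,
        ← ENNReal.mul_rpow_of_nonneg _ _ hs.le]
      refine ENNReal.one_le_rpow ?_ hs
      rw [← ofReal_norm, hκ, ← ENNReal.ofReal_mul (by positivity), ENNReal.one_le_ofReal,
        Real.norm_eq_abs, div_mul_eq_mul_div, one_le_div ha]
      linarith
    · rw [Set.indicator_of_notMem (show x ∉ {x | a / 2 < |u n x|} from hx)]
      exact zero_le
  have hint : ∀ (ν : Measure E) (n : ℕ) (W : ℝ≥0∞), ν ≤ μ → ν {x | a / 2 < |u n x|} ≤ W →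
      ∫⁻ x, (‖G (u n x)‖ₑ + ‖fderiv ℝ (fun x ↦ G (u n x)) x‖ₑ) ∂ν ≤
        W + M' * (W ^ (1 / 2 : ℝ) * K ^ (1 / 2 : ℝ)) := by
    intro ν n W hν hW
    have hm := (hu n).continuous_fderiv one_ne_zero
    have him : Measurable ({x | a / 2 < |u n x|}.indicator (1 : E → ℝ≥0∞)) :=
      measurable_one.indicator (hAm n)
    refine (lintegral_mono (hA n)).trans ?_
    rw [lintegral_add_left him, lintegral_const_mul _ (by fun_prop),
      lintegral_indicator_one (hAm n)]
    gcongr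
    refine (ENNReal.lintegral_mul_le_Lp_mul_Lq ν Real.HolderConjugate.two_two
      him.aemeasurable (by fun_prop)).trans ?_
    gcongr
    · refine le_trans (le_of_eq ?_) hW
      rw [← lintegral_indicator_one (hAm n)]
      refine lintegral_congr fun x ↦ ?_
      by_cases hx : x ∈ {x | a / 2 < |u n x|} <;> simp [hx]
    · exact (lintegral_mono' hν le_rfl).trans (huK n)
  set F : ℝ≥0∞ → ℝ≥0∞ := fun W ↦ W + M' * (W ^ (1 / 2 : ℝ) * K ^ (1 / 2 : ℝ)) with hF
  have hF0 : Tendsto (fun n ↦ F (κ ^ (2 : ℝ) * δ n)) atTop (𝓝 0) := by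
    have h1 : Tendsto (fun n ↦ κ ^ (2 : ℝ) * δ n) atTop (𝓝 0) := by
      simpa using ENNReal.Tendsto.const_mul hδ (Or.inr (by finiteness : κ ^ (2 : ℝ) ≠ ∞))
    have h2 : Tendsto (fun n ↦ (κ ^ (2 : ℝ) * δ n) ^ (1 / 2 : ℝ)) atTop (𝓝 0) := by
      simpa using h1.ennrpow_const (1 / 2)
    have hK' : K ^ (1 / 2 : ℝ) ≠ ∞ := by finiteness
    have h3 := ENNReal.Tendsto.mul_const h2 (Or.inr hK')
    have h4 := ENNReal.Tendsto.const_mul h3 (Or.inr (by finiteness : M' ≠ ∞))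
    simpa [hF] using h1.add h4
  set T := F (κ ^ q * S)
  have hT : T ≠ ∞ := by
    simp only [T, hF]
    finiteness
  have hlim : Tendsto (fun n ↦ C * F (κ ^ (2 : ℝ) * δ n) ^ (p - 1) * T) atTop (𝓝 0) := by
    have h1 := hF0.ennrpow_const (p - 1)
    rw [ENNReal.zero_rpow_of_pos (sub_pos.2 hp.symm.lt)] at h1
    simpa using ENNReal.Tendsto.mul_const (ENNReal.Tendsto.const_mul h1 (Or.inr hC)) (Or.inr hT)
  refine tendsto_of_tendsto_of_tendsto_of_le_of_le' tendsto_const_nhds hlim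
    (Eventually.of_forall fun _ ↦ zero_le) ?_
  filter_upwards [hF0.eventually (gt_mem_nhds ENNReal.zero_lt_top)] with n hn
  have hum := (hu n).continuous
  have hGm := hG.continuous
  calc μ {x | a ≤ |u n x|}
      ≤ ∫⁻ x, ‖G (u n x)‖ₑ ^ p ∂μ := by
        have hm : MeasurableSet {x | a ≤ |u n x|} :=
          measurableSet_le measurable_const hum.measurable.abs
        rw [← lintegral_indicator_one hm]
        refine lintegral_mono fun x ↦ ?_
        by_cases hx : a ≤ |u n x|
        · simp [hG1 _ hx, hx]
        · rw [Set.indicator_of_notMem (show x ∉ {x | a ≤ |u n x|} from hx)]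
          exact zero_le
    _ ≤ C * F (κ ^ (2 : ℝ) * δ n) ^ (p - 1) *
          ∫⁻ x, (‖G (u n x)‖ₑ + ‖fderiv ℝ (fun x ↦ G (u n x)) x‖ₑ) ∂μ := by
        refine hCf _ (hG.comp (hu n)) ((hus n).comp_left (hG0 0 (by simp; positivity)).1) _ hn.ne
          fun y ↦ hint _ n _ Measure.restrict_le_self ((hcheb _ n 2 (by norm_num)).trans ?_)
        gcongr
        exact huδ n y
    _ ≤ C * F (κ ^ (2 : ℝ) * δ n) ^ (p - 1) * T := by
        gcongr
        refine hint μ n _ le_rfl ((hcheb μ n q hq).trans ?_)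
        gcongr
        exact huS n

/-- A continuous function that is `o(|s|^q)` at zero and at infinity is bounded by `c |s|^q` away
from a region where `|s|` is bounded below and the function is bounded. -/
theorem exists_le_mul_rpow_or_le {Ψ : ℝ → ℝ} {q : ℝ} (hq : 0 < q) (hΨ : Continuous Ψ)
    (hΨ_zero : Tendsto (fun s : ℝ ↦ Ψ s / |s| ^ q) (𝓝[≠] 0) (𝓝 0))
    (hΨ_infty : Tendsto (fun s : ℝ ↦ Ψ s / |s| ^ q) (cocompact ℝ) (𝓝 0))
    {c : ℝ} (hc : 0 < c) :
    ∃ a M : ℝ, 0 < a ∧ ∀ s, Ψ s ≤ c * |s| ^ q ∨ a ≤ |s| ∧ Ψ s ≤ M := by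
  have hpow {s : ℝ} (hs : s ≠ 0) (h : Ψ s / |s| ^ q < c) : Ψ s ≤ c * |s| ^ q :=
    ((div_lt_iff₀ (Real.rpow_pos_of_pos (abs_pos.2 hs) q)).1 h).le
  have h0 : ∀ᶠ s in 𝓝[≠] (0 : ℝ), Ψ s ≤ c * |s| ^ q := by
    filter_upwards [hΨ_zero.eventually (gt_mem_nhds hc), self_mem_nhdsWithin] with s hs hs'
    exact hpow hs' hs
  have hz : Ψ 0 ≤ c * |0| ^ q :=
    le_of_tendsto_of_tendsto (b := 𝓝[≠] (0 : ℝ)) hΨ.continuousAt.continuousWithinAt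
      (by
        have : Continuous fun s : ℝ ↦ c * |s| ^ q :=
          continuous_const.mul (continuous_abs.rpow_const fun _ ↦ Or.inr hq.le)
        exact this.continuousAt.continuousWithinAt) h0
  obtain ⟨a, ha, haΨ⟩ := Metric.mem_nhdsWithin_iff.1 h0
  obtain ⟨t, ht, htΨ⟩ := mem_cocompact.1 (hΨ_infty.eventually (gt_mem_nhds hc))
  obtain ⟨M, hM⟩ := (ht.bddAbove_image hΨ.continuousOn)
  refine ⟨a, M, ha, fun s ↦ ?_⟩
  rcases eq_or_ne s 0 with rfl | hs
  · exact Or.inl hz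
  by_cases hst : s ∈ t
  · by_cases hsa : a ≤ |s|
    · exact Or.inr ⟨hsa, hM ⟨s, hst, rfl⟩⟩
    · exact Or.inl (haΨ ⟨by simpa using hsa, hs⟩)
  · exact Or.inl (hpow hs (htΨ hst))

/-- If `u n` is bounded in `L^q` and tends to zero in measure, and `Ψ` is `o(|s|^q)` at zero and
at infinity, then `∫ Ψ (u n)` tends to zero. -/
theorem tendsto_lintegral_comp_of_tendsto_measure_le_abs
    {α : Type*} [MeasurableSpace α] {μ : Measure α} {u : ℕ → α → ℝ}
    (hu : ∀ n, Measurable (u n)) {Ψ : ℝ → ℝ} {q : ℝ} (hq : 0 < q) (hΨ : Continuous Ψ)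
    (hΨ_zero : Tendsto (fun s : ℝ ↦ Ψ s / |s| ^ q) (𝓝[≠] 0) (𝓝 0))
    (hΨ_infty : Tendsto (fun s : ℝ ↦ Ψ s / |s| ^ q) (cocompact ℝ) (𝓝 0))
    {S : ℝ≥0∞} (hS : S ≠ ∞) (huS : ∀ n, ∫⁻ x, ‖u n x‖ₑ ^ q ∂μ ≤ S)
    (hmeas : ∀ a : ℝ, 0 < a → Tendsto (fun n ↦ μ {x | a ≤ |u n x|}) atTop (𝓝 0)) :
    Tendsto (fun n ↦ ∫⁻ x, ENNReal.ofReal (Ψ (u n x)) ∂μ) atTop (𝓝 0) := by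
  rw [ENNReal.tendsto_nhds_zero]
  intro ε hε
  have hε2 : 0 < ε / 2 := ENNReal.half_pos hε.ne'
  obtain ⟨c, hcS, hc⟩ : ∃ c : ℝ, ENNReal.ofReal c * S < ε / 2 ∧ 0 < c := by
    have h1 : Tendsto (fun c : ℝ ↦ ENNReal.ofReal c * S) (𝓝[>] 0) (𝓝 0) := by
      have := ENNReal.Tendsto.mul_const (ENNReal.tendsto_ofReal (tendsto_id (α := ℝ) (x := 𝓝 0)))
        (Or.inr hS)
      simp only [id, ENNReal.ofReal_zero, zero_mul] at this
      exact this.mono_left nhdsWithin_le_nhds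
    exact ((h1.eventually (gt_mem_nhds hε2)).and self_mem_nhdsWithin).exists
  obtain ⟨a, M, ha, hM⟩ := exists_le_mul_rpow_or_le hq hΨ hΨ_zero hΨ_infty hc
  have hlim : Tendsto (fun n ↦ ENNReal.ofReal M * μ {x | a ≤ |u n x|}) atTop (𝓝 0) := by
    simpa using ENNReal.Tendsto.const_mul (hmeas a ha) (Or.inr (ENNReal.ofReal_ne_top (r := M)))
  filter_upwards [hlim.eventually (gt_mem_nhds hε2)] with n hn
  have hum := hu n
  have hm : MeasurableSet {x | a ≤ |u n x|} := measurableSet_le measurable_const hum.abs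
  have him : Measurable ({x | a ≤ |u n x|}.indicator (1 : α → ℝ≥0∞)) := measurable_one.indicator hm
  calc ∫⁻ x, ENNReal.ofReal (Ψ (u n x)) ∂μ
      ≤ ∫⁻ x, (ENNReal.ofReal c * ‖u n x‖ₑ ^ q +
          ENNReal.ofReal M * {x | a ≤ |u n x|}.indicator 1 x) ∂μ := by
        refine lintegral_mono fun x ↦ ?_
        rcases hM (u n x) with h | ⟨h, h'⟩
        · refine (ENNReal.ofReal_le_ofReal h).trans (le_add_right (le_of_eq ?_))
          rw [ENNReal.ofReal_mul hc.le, ← ENNReal.ofReal_rpow_of_nonneg (abs_nonneg _) hq.le,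
            ← Real.norm_eq_abs, ofReal_norm]
        · rw [Set.indicator_of_mem (show x ∈ {x | a ≤ |u n x|} from h), Pi.one_apply, mul_one]
          exact le_add_left (ENNReal.ofReal_le_ofReal h')
    _ = ENNReal.ofReal c * ∫⁻ x, ‖u n x‖ₑ ^ q ∂μ +
          ENNReal.ofReal M * μ {x | a ≤ |u n x|} := by
        rw [lintegral_add_left (by fun_prop), lintegral_const_mul _ (by fun_prop),
          lintegral_const_mul _ him, lintegral_indicator_one hm]
    _ ≤ ENNReal.ofReal c * S + ENNReal.ofReal M * μ {x | a ≤ |u n x|} := by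
        gcongr
        exact huS n
    _ ≤ ε / 2 + ε / 2 := add_le_add hcS.le hn.le
    _ = ε := ENNReal.add_halves ε

/-- Lemma 1.6 of the paper (a variant of Lions' lemma in `D^{1,2}(ℝ^N)`):
if `(u_n)` is bounded in the gradient `L²` norm and
`sup_{y} ∫_{B(y,r)} |u_n|² → 0` for some `r > 0`, then `∫ Ψ(u_n) → 0`
for every continuous `Ψ : ℝ → [0,∞)` with `Ψ(s)/|s|^{2*} → 0` both as
`s → 0` and as `|s| → ∞`. -/
theorem lions_lemma_D12
    (N : ℕ) (hN : 3 ≤ N)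
    (u : ℕ → EuclideanSpace ℝ (Fin N) → ℝ)
    (hu_smooth : ∀ n, ContDiff ℝ (⊤ : ℕ∞) (u n))
    (hu_supp : ∀ n, HasCompactSupport (u n))
    (hu_bdd : ∃ C : ℝ, ∀ n, ∫ x, ‖gradient (u n) x‖ ^ 2 ≤ C)
    (r : ℝ) (hr : 0 < r)
    (hvanish : Tendsto
      (fun n => ⨆ y : EuclideanSpace ℝ (Fin N), ∫ x in Metric.ball y r, (u n x) ^ 2)
      atTop (𝓝 0))
    (Ψ : ℝ → ℝ) (hΨ_cont : Continuous Ψ) (hΨ_nonneg : ∀ s, 0 ≤ Ψ s)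
    (hΨ_zero : Tendsto (fun s : ℝ => Ψ s / |s| ^ ((2 * N : ℝ) / (N - 2)))
      (𝓝[≠] 0) (𝓝 0))
    (hΨ_infty : Tendsto (fun s : ℝ => Ψ s / |s| ^ ((2 * N : ℝ) / (N - 2)))
      (cocompact ℝ) (𝓝 0)) :
    Tendsto (fun n => ∫ x, Ψ (u n x)) atTop (𝓝 0) := by
  obtain ⟨C, hC⟩ := hu_bdd
  have hN' : (3 : ℝ) ≤ N := by exact_mod_cast hN
  have hN2 : (0 : ℝ) < N - 2 := by linarith
  set q : ℝ := (2 * N : ℝ) / (N - 2) with hq_def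
  have hq : 0 < q := by positivity
  have hu1 : ∀ n, ContDiff ℝ 1 (u n) := fun n ↦ (hu_smooth n).of_le (by exact_mod_cast le_top)
  have hcont : ∀ n, Continuous (u n) := fun n ↦ (hu1 n).continuous
  have hgrad : ∀ n x, ‖gradient (u n) x‖ = ‖fderiv ℝ (u n) x‖ := fun n x ↦
    LinearIsometryEquiv.norm_map _ _
  have hK : ∀ n, ∫⁻ x, ‖fderiv ℝ (u n) x‖ₑ ^ (2 : ℝ) ≤ ENNReal.ofReal C := by
    intro n
    have hd := (hu1 n).continuous_fderiv one_ne_zero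
    have hint : Integrable (fun x ↦ ‖fderiv ℝ (u n) x‖ ^ 2) :=
      Continuous.integrable_of_hasCompactSupport (by fun_prop)
        (((hu_supp n).fderiv ℝ).comp_left
          (g := fun L : EuclideanSpace ℝ (Fin N) →L[ℝ] ℝ ↦ ‖L‖ ^ 2) (by simp))
    have h := hC n
    simp_rw [hgrad] at h
    refine le_trans (le_of_eq ?_) (ENNReal.ofReal_le_ofReal h)
    rw [ofReal_integral_eq_lintegral_ofReal hint (Eventually.of_forall fun _ ↦ by positivity)]
    refine lintegral_congr fun x ↦ ?_
    rw [ENNReal.ofReal_pow (norm_nonneg _), ofReal_norm, ENNReal.rpow_ofNat]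
  obtain ⟨S, hS, huS⟩ : ∃ S : ℝ≥0∞, S ≠ ∞ ∧ ∀ n, ∫⁻ x, ‖u n x‖ₑ ^ q ≤ S := by
    refine ⟨(eLpNormLESNormFDerivOfEqInnerConst
      (volume : Measure (EuclideanSpace ℝ (Fin N))) (2 : ℝ≥0) *
        ENNReal.ofReal C ^ (1 / 2 : ℝ)) ^ q, by finiteness, fun n ↦ ?_⟩
    have hs := eLpNorm_le_eLpNorm_fderiv_of_eq_inner volume (hu1 n) (hu_supp n)
      (p := 2) (p' := q.toNNReal) one_le_two (by simp; omega) (by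
        rw [Real.coe_toNNReal _ hq.le, finrank_euclideanSpace_fin, hq_def]
        push_cast
        field_simp)
    have hpow := eLpNorm_nnreal_pow_eq_lintegral (μ := volume) (f := u n)
      (p := q.toNNReal) (by simpa using hq)
    rw [Real.coe_toNNReal _ hq.le] at hpow
    rw [← hpow]
    gcongr
    refine hs.trans ?_
    gcongr
    rw [eLpNorm_nnreal_eq_lintegral two_ne_zero]
    push_cast
    gcongr
    exact hK n
  have hδ : Tendsto (fun n ↦ ENNReal.ofReal
      (⨆ y : EuclideanSpace ℝ (Fin N), ∫ x in Metric.ball y r, (u n x) ^ 2)) atTop (𝓝 0) := by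
    simpa using ENNReal.tendsto_ofReal hvanish
  have huδ : ∀ n (y : EuclideanSpace ℝ (Fin N)),
      ∫⁻ x in Metric.ball y r, ‖u n x‖ₑ ^ (2 : ℝ) ≤ ENNReal.ofReal
        (⨆ y : EuclideanSpace ℝ (Fin N), ∫ x in Metric.ball y r, (u n x) ^ 2) := by
    intro n y
    have hint : Integrable (fun x ↦ u n x ^ 2) :=
      Continuous.integrable_of_hasCompactSupport (by fun_prop)
        ((hu_supp n).comp_left (g := fun t : ℝ ↦ t ^ 2) (by simp))
    have hbdd : BddAbove (Set.range fun y : EuclideanSpace ℝ (Fin N) ↦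
        ∫ x in Metric.ball y r, (u n x) ^ 2) := by
      refine ⟨∫ x, (u n x) ^ 2, ?_⟩
      rintro _ ⟨y, rfl⟩
      exact setIntegral_le_integral hint (Eventually.of_forall fun x ↦ sq_nonneg (u n x))
    refine le_trans (le_of_eq ?_) (ENNReal.ofReal_le_ofReal (le_ciSup hbdd y))
    rw [ofReal_integral_eq_lintegral_ofReal hint.restrict
      (Eventually.of_forall fun x ↦ sq_nonneg (u n x))]
    refine lintegral_congr fun x ↦ ?_
    rw [← sq_abs, ENNReal.ofReal_pow (abs_nonneg _), ← Real.norm_eq_abs, ofReal_norm,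
      ENNReal.rpow_ofNat]
  have hlim := tendsto_lintegral_comp_of_tendsto_measure_le_abs (μ := volume)
    (fun n ↦ (hcont n).measurable) hq hΨ_cont hΨ_zero hΨ_infty hS huS fun a ha ↦
      tendsto_measure_le_abs_of_setLIntegral_ball_tendsto_zero volume (by simp; omega) hu1 hu_supp
        ENNReal.ofReal_ne_top hS hK hq huS hr hδ huδ ha
  have hreal := (ENNReal.tendsto_toReal ENNReal.zero_ne_top).comp hlim
  refine hreal.congr fun n ↦ ?_
  exact (integral_eq_lintegral_of_nonneg_ae (Eventually.of_forall fun x ↦ hΨ_nonneg _)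
    (hΨ_cont.comp (hcont n)).aestronglyMeasurable).symm
end

section
/- Let N ≥ 3 and 2* = 2N/(N−2). Let g : ℝ → ℝ be continuous, G(s) = ∫₀^s g(t) dt, and let u : ℝ^N → ℝ be a twice continuously differentiable function such that −Δu(x) = g(u(x)) for every x ∈ ℝ^N, ∫_{ℝ^N} |∇u|² dx < ∞, and the function x ↦ G(u(x)) is Lebesgue integrable on ℝ^N. Then the Pohozaev identity holds: ∫_{ℝ^N} |∇u|² dx = 2* ∫_{ℝ^N} G(u(x)) dx. -/
open MeasureTheory Filter Topology

/-- The Laplacian of a function on `ℝ^N`: the sum of its second partial derivatives. -/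
noncomputable def laplacian {N : ℕ} (u : EuclideanSpace ℝ (Fin N) → ℝ)
    (x : EuclideanSpace ℝ (Fin N)) : ℝ :=
  ∑ i : Fin N,
    fderiv ℝ (fun y => fderiv ℝ u y (EuclideanSpace.single i 1)) x (EuclideanSpace.single i 1)

theorem integral_divergence_eq_zero_of_abs_le {N : ℕ}
    {W : Fin N → EuclideanSpace ℝ (Fin N) → ℝ} (hW : ∀ i, ContDiff ℝ 1 (W i))
    {m : EuclideanSpace ℝ (Fin N) → ℝ} (hm : Integrable m)
    (hWm : ∀ i x, |W i x| ≤ ‖x‖ * m x)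
    (hint : Integrable fun x => ∑ i, fderiv ℝ (W i) x (EuclideanSpace.single i 1)) :
    ∫ x, ∑ i, fderiv ℝ (W i) x (EuclideanSpace.single i 1) = 0 := by
  let φ : ContDiffBump (0 : EuclideanSpace ℝ (Fin N)) := ⟨1, 2, one_pos, one_lt_two⟩
  have hφ : ContDiff ℝ 1 φ := φ.contDiff
  have hφc : Continuous (fderiv ℝ φ) := hφ.continuous_fderiv one_ne_zero
  obtain ⟨C, hC⟩ := (φ.hasCompactSupport.fderiv (𝕜 := ℝ)).exists_bound_of_continuous hφc
  have hC0 : 0 ≤ C := (norm_nonneg _).trans (hC 0)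
  have hC2 (y : EuclideanSpace ℝ (Fin N)) : ‖fderiv ℝ φ y‖ * ‖y‖ ≤ C * 2 := by
    by_cases hy : y ∈ tsupport φ
    · rw [φ.tsupport_eq, mem_closedBall_zero_iff] at hy
      exact mul_le_mul (hC y) hy (norm_nonneg _) hC0
    · rw [fderiv_of_notMem_tsupport ℝ hy]
      simpa using hC0
  let ε : ℕ → ℝ := fun n => 1 / ((n : ℝ) + 1)
  have hε (n) : 0 < ε n := Nat.one_div_pos_of_nat
  have hεt : Tendsto ε atTop (𝓝 0) := tendsto_one_div_add_atTop_nhds_zero_nat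
  let ψ : ℕ → EuclideanSpace ℝ (Fin N) → ℝ := fun n x => φ (ε n • x)
  have hψ (n) : ContDiff ℝ 1 (ψ n) := hφ.comp (contDiff_const_smul _)
  have hψs (n) : HasCompactSupport (ψ n) :=
    φ.hasCompactSupport.comp_homeomorph (Homeomorph.smulOfNeZero (ε n) (hε n).ne')
  have hψd (n x v) : fderiv ℝ (ψ n) x v = ε n * fderiv ℝ φ (ε n • x) v := by
    have h1 : HasFDerivAt (fun x : EuclideanSpace ℝ (Fin N) => ε n • x)
        (ε n • ContinuousLinearMap.id ℝ _) x :=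
      (hasFDerivAt_id x).fun_const_smul _
    have h2 := ((hφ.differentiable one_ne_zero (ε n • x)).hasFDerivAt).comp x h1
    have h3 : fderiv ℝ (ψ n) x = _ := h2.fderiv
    rw [h3]
    simp
  have hWd (i) : Continuous fun x => fderiv ℝ (W i) x (EuclideanSpace.single i 1) :=
    ((hW i).continuous_fderiv one_ne_zero).clm_apply continuous_const
  have hψdc (n i) :
      Continuous fun x => fderiv ℝ (ψ n) x (EuclideanSpace.single i (1 : ℝ)) :=
    ((hψ n).continuous_fderiv one_ne_zero).clm_apply continuous_const
  have hψds (n i) :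
      HasCompactSupport fun x => fderiv ℝ (ψ n) x (EuclideanSpace.single i (1 : ℝ)) :=
    (hψs n).fderiv_apply (𝕜 := ℝ) _
  have hi1 (n i) :
      Integrable fun x => ψ n x * fderiv ℝ (W i) x (EuclideanSpace.single i 1) :=
    ((hψ n).continuous.mul (hWd i)).integrable_of_hasCompactSupport (hψs n).mul_right
  have hi2 (n i) :
      Integrable fun x => fderiv ℝ (ψ n) x (EuclideanSpace.single i 1) * W i x :=
    ((hψdc n i).mul (hW i).continuous).integrable_of_hasCompactSupport (hψds n i).mul_right
  have hparts (n) :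
      ∫ x, ψ n x * ∑ i, fderiv ℝ (W i) x (EuclideanSpace.single i 1) =
        -∫ x, ∑ i, fderiv ℝ (ψ n) x (EuclideanSpace.single i 1) * W i x := by
    simp_rw [Finset.mul_sum]
    rw [integral_finsetSum _ fun i _ => hi1 n i, integral_finsetSum _ fun i _ => hi2 n i,
      ← Finset.sum_neg_distrib]
    refine Finset.sum_congr rfl fun i _ => ?_
    exact integral_mul_fderiv_eq_neg_fderiv_mul_of_integrable (hi2 n i) (hi1 n i)
      (((hψ n).continuous.mul (hW i).continuous).integrable_of_hasCompactSupport
        (hψs n).mul_right)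
      (fun x _ => (hψ n).differentiable one_ne_zero x)
      (fun x _ => (hW i).differentiable one_ne_zero x)
  have hlim1 : Tendsto (fun n => ∫ x, ψ n x * ∑ i, fderiv ℝ (W i) x (EuclideanSpace.single i 1))
      atTop (𝓝 (∫ x, ∑ i, fderiv ℝ (W i) x (EuclideanSpace.single i 1))) := by
    refine tendsto_integral_of_dominated_convergence _ (fun n => ?_) hint.norm (fun n => ?_) ?_
    · exact ((hψ n).continuous.mul
        (continuous_finsetSum _ fun i _ => hWd i)).aestronglyMeasurable
    · refine .of_forall fun x => ?_
      rw [norm_mul]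
      refine mul_le_of_le_one_left (norm_nonneg _) ?_
      rw [Real.norm_of_nonneg φ.nonneg]
      exact φ.le_one
    · refine .of_forall fun x => ?_
      have h1 : Tendsto (fun n => ψ n x) atTop (𝓝 1) := by
        have h0 : φ 0 = 1 := φ.one_of_mem_closedBall (by simp [φ])
        have : Tendsto (fun n => φ (ε n • x)) atTop (𝓝 (φ ((0 : ℝ) • x))) :=
          (hφ.continuous.tendsto _).comp (hεt.smul_const x)
        rwa [zero_smul, h0] at this
      simpa using h1.mul_const _
  have hsum (n x) : ‖∑ i, fderiv ℝ (ψ n) x (EuclideanSpace.single i 1) * W i x‖ ≤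
      ∑ i, ε n * ‖fderiv ℝ φ (ε n • x)‖ * |W i x| := by
    refine norm_sum_le_of_le _ fun i _ => ?_
    rw [hψd, norm_mul, norm_mul, Real.norm_of_nonneg (hε n).le, Real.norm_eq_abs (W i x)]
    have := (hε n).le
    gcongr
    simpa using (fderiv ℝ φ (ε n • x)).le_opNorm (EuclideanSpace.single i 1)
  have hlim2 : Tendsto (fun n => ∫ x, ∑ i, fderiv ℝ (ψ n) x (EuclideanSpace.single i 1) * W i x)
      atTop (𝓝 (∫ _ : EuclideanSpace ℝ (Fin N), (0 : ℝ))) := by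
    refine tendsto_integral_of_dominated_convergence (fun x => N * (C * 2 * |m x|))
      (fun n => ?_) ((hm.abs.const_mul _).const_mul _) (fun n => ?_) ?_
    · exact (continuous_finsetSum _ fun i _ =>
        (hψdc n i).mul (hW i).continuous).aestronglyMeasurable
    · refine .of_forall fun x => (hsum n x).trans ?_
      refine (Finset.sum_le_card_nsmul _ _ (C * 2 * |m x|) fun i _ => ?_).trans_eq (by simp)
      have h1 := hC2 (ε n • x)
      rw [norm_smul, Real.norm_of_nonneg (hε n).le] at h1
      calc ε n * ‖fderiv ℝ φ (ε n • x)‖ * |W i x|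
          ≤ ε n * ‖fderiv ℝ φ (ε n • x)‖ * (‖x‖ * |m x|) := by
            have := (hε n).le
            gcongr
            exact (hWm i x).trans (by gcongr; exact le_abs_self _)
        _ = ‖fderiv ℝ φ (ε n • x)‖ * (ε n * ‖x‖) * |m x| := by ring
        _ ≤ C * 2 * |m x| := by gcongr
    · refine .of_forall fun x => ?_
      have h1 : Tendsto (fun n => ε n * (C * ∑ i, |W i x|)) atTop (𝓝 0) := by
        simpa using hεt.mul_const _
      refine squeeze_zero_norm (fun n => (hsum n x).trans ?_) h1
      rw [← Finset.mul_sum, mul_assoc]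
      have := (hε n).le
      gcongr
      exact hC _
  simp_rw [hparts] at hlim1
  have := tendsto_nhds_unique hlim1 hlim2.neg
  simpa using this

theorem map_eq_sum_coord_mul {N : ℕ} (L : EuclideanSpace ℝ (Fin N) →L[ℝ] ℝ)
    (x : EuclideanSpace ℝ (Fin N)) :
    L x = ∑ i, x i * L (EuclideanSpace.single i 1) := by
  conv_lhs => rw [← (EuclideanSpace.basisFun (Fin N) ℝ).sum_repr x]
  simp

theorem fderiv_single_eq_gradient {N : ℕ} (u : EuclideanSpace ℝ (Fin N) → ℝ)
    (x : EuclideanSpace ℝ (Fin N)) (i : Fin N) :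
    fderiv ℝ u x (EuclideanSpace.single i 1) = gradient u x i := by
  rw [← toDual_gradient, InnerProductSpace.toDual_apply_apply, EuclideanSpace.inner_single_right]
  simp

theorem norm_fderiv_eq_norm_gradient {N : ℕ} (u : EuclideanSpace ℝ (Fin N) → ℝ)
    (x : EuclideanSpace ℝ (Fin N)) : ‖fderiv ℝ u x‖ = ‖gradient u x‖ := by
  rw [← toDual_gradient, LinearIsometryEquiv.norm_map]

theorem norm_gradient_sq_eq_sum {N : ℕ} (u : EuclideanSpace ℝ (Fin N) → ℝ)
    (x : EuclideanSpace ℝ (Fin N)) :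
    ‖gradient u x‖ ^ 2 = ∑ i, fderiv ℝ u x (EuclideanSpace.single i 1) ^ 2 := by
  simp_rw [fderiv_single_eq_gradient, EuclideanSpace.norm_sq_eq, Real.norm_eq_abs, sq_abs]

/-- The `i`-th component of the Pohozaev field `(x · ∇u) ∇u + (F(u) - |∇u|² / 2) x`. -/
noncomputable def pohozaevField {N : ℕ} (F : ℝ → ℝ) (u : EuclideanSpace ℝ (Fin N) → ℝ)
    (i : Fin N) (x : EuclideanSpace ℝ (Fin N)) : ℝ :=
  fderiv ℝ u x (EuclideanSpace.single i 1) * fderiv ℝ u x x +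
    x i * (F (u x) - (∑ j, fderiv ℝ u x (EuclideanSpace.single j 1) ^ 2) / 2)

theorem contDiff_pohozaevField {N : ℕ} {F : ℝ → ℝ} (hF : ContDiff ℝ 1 F)
    {u : EuclideanSpace ℝ (Fin N) → ℝ} (hu : ContDiff ℝ 2 u) (i : Fin N) :
    ContDiff ℝ 1 (pohozaevField F u i) := by
  have hu' : ContDiff ℝ 1 (fderiv ℝ u) := hu.fderiv_right (by norm_num [one_add_one_eq_two])
  have hu1 : ContDiff ℝ 1 u := hu.of_le one_le_two
  have hx : ContDiff ℝ 1 fun x : EuclideanSpace ℝ (Fin N) => x i :=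
    (EuclideanSpace.proj (𝕜 := ℝ) i).contDiff
  have hp (j : Fin N) : ContDiff ℝ 1 fun x => fderiv ℝ u x (EuclideanSpace.single j 1) :=
    hu'.clm_apply contDiff_const
  exact ((hp i).mul (hu'.clm_apply contDiff_id)).add
    (hx.mul ((hF.comp hu1).sub ((ContDiff.sum fun j _ => (hp j).pow 2).div_const 2)))

theorem abs_pohozaevField_le {N : ℕ} (F : ℝ → ℝ) (u : EuclideanSpace ℝ (Fin N) → ℝ)
    (i : Fin N) (x : EuclideanSpace ℝ (Fin N)) :
    |pohozaevField F u i x| ≤ ‖x‖ * (3 / 2 * ‖gradient u x‖ ^ 2 + |F (u x)|) := by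
  rw [pohozaevField, ← norm_gradient_sq_eq_sum]
  have h1 : |fderiv ℝ u x (EuclideanSpace.single i 1)| ≤ ‖gradient u x‖ := by
    rw [fderiv_single_eq_gradient]
    exact PiLp.norm_apply_le (gradient u x) i
  have h2 : |fderiv ℝ u x x| ≤ ‖gradient u x‖ * ‖x‖ := by
    rw [← norm_fderiv_eq_norm_gradient]
    exact (fderiv ℝ u x).le_opNorm x
  have h3 : |x i| ≤ ‖x‖ := PiLp.norm_apply_le x i
  have h4 : |F (u x) - ‖gradient u x‖ ^ 2 / 2| ≤ |F (u x)| + ‖gradient u x‖ ^ 2 / 2 :=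
    (abs_sub _ _).trans_eq (by rw [abs_of_nonneg (a := ‖gradient u x‖ ^ 2 / 2) (by positivity)])
  refine (abs_add_le _ _).trans ?_
  rw [abs_mul, abs_mul]
  calc _ ≤ ‖gradient u x‖ * (‖gradient u x‖ * ‖x‖) +
        ‖x‖ * (|F (u x)| + ‖gradient u x‖ ^ 2 / 2) := by gcongr
    _ = _ := by ring

theorem sum_fderiv_pohozaevField {N : ℕ} {F : ℝ → ℝ} (hF : Differentiable ℝ F)
    {u : EuclideanSpace ℝ (Fin N) → ℝ} (hu : ContDiff ℝ 2 u)
    (x : EuclideanSpace ℝ (Fin N)) (heq : -laplacian u x = deriv F (u x)) :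
    ∑ i, fderiv ℝ (pohozaevField F u i) x (EuclideanSpace.single i 1) =
      (1 - N / 2) * ‖gradient u x‖ ^ 2 + N * F (u x) := by
  have hu' : HasFDerivAt (fderiv ℝ u) (fderiv ℝ (fderiv ℝ u) x) x :=
    ((hu.fderiv_right (m := 1) (by norm_num [one_add_one_eq_two])).differentiable
      one_ne_zero x).hasFDerivAt
  have hu1 : HasFDerivAt u (fderiv ℝ u x) x :=
    (hu.differentiable two_ne_zero x).hasFDerivAt
  have hsymm : IsSymmSndFDerivAt ℝ u x := hu.contDiffAt.isSymmSndFDerivAt (by simp)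
  set D := fderiv ℝ (fderiv ℝ u) x
  set L := fderiv ℝ u x with hL
  let e : Fin N → EuclideanSpace ℝ (Fin N) := fun i => EuclideanSpace.single i 1
  have hp (v : EuclideanSpace ℝ (Fin N)) :
      HasFDerivAt (fun y => fderiv ℝ u y v) (D.flip v) x :=
    (hu'.clm_apply (hasFDerivAt_const v x)).congr_fderiv (by ext w; simp)
  have hlap : laplacian u x = ∑ i, D (e i) (e i) := by
    refine Finset.sum_congr rfl fun i _ => ?_
    rw [(hp _).fderiv]
    rfl
  have hS : HasFDerivAt (fun y => fderiv ℝ u y y) (L + D.flip x) x :=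
    (hu'.clm_apply (hasFDerivAt_id x)).congr_fderiv (by ext w; simp [hL])
  have hFu : HasFDerivAt (fun y => F (u y)) (deriv F (u x) • L) x :=
    (hF (u x)).hasDerivAt.comp_hasFDerivAt x hu1
  have hx (i : Fin N) : HasFDerivAt (fun y : EuclideanSpace ℝ (Fin N) => y i)
      (EuclideanSpace.proj (𝕜 := ℝ) i) x := (EuclideanSpace.proj (𝕜 := ℝ) i).hasFDerivAt
  have hQ : HasFDerivAt (fun y => (∑ j, fderiv ℝ u y (e j) ^ 2) / 2)
      (∑ j, L (e j) • D.flip (e j)) x := by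
    have h := (HasFDerivAt.fun_sum (u := Finset.univ) fun j _ => (hp (e j)).pow 2).mul_const
      (2⁻¹ : ℝ)
    simp_rw [← div_eq_mul_inv] at h
    refine h.congr_fderiv ?_
    ext w
    simp [Finset.mul_sum]
    refine Finset.sum_congr rfl fun j _ => ?_
    ring
  have hterm (i : Fin N) : fderiv ℝ (pohozaevField F u i) x (e i) =
      D (e i) (e i) * L x + (L (e i) ^ 2 + L (e i) * D (e i) x) +
        (F (u x) - ‖gradient u x‖ ^ 2 / 2) +
        (deriv F (u x) * (x i * L (e i)) - x i * ∑ j, L (e j) * D (e i) (e j)) := by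
    have h := ((hp (e i)).mul hS).add ((hx i).mul (hFu.sub hQ))
    have h' : fderiv ℝ (pohozaevField F u i) x = _ := h.fderiv
    rw [h', norm_gradient_sq_eq_sum]
    simp [e, ← hL]
    ring
  have hcross : ∑ i, L (e i) * D (e i) x = ∑ i, x i * ∑ j, L (e j) * D (e i) (e j) := by
    simp_rw [map_eq_sum_coord_mul (D _) x, Finset.mul_sum]
    rw [Finset.sum_comm]
    refine Finset.sum_congr rfl fun i _ => Finset.sum_congr rfl fun j _ => ?_
    rw [show D (e i) (e j) = D (e j) (e i) from hsymm _ _]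
    ring
  have hLx : ∑ i, x i * L (e i) = L x := (map_eq_sum_coord_mul L x).symm
  have hQx : ∑ i, L (e i) ^ 2 = ‖gradient u x‖ ^ 2 := (norm_gradient_sq_eq_sum u x).symm
  rw [Finset.sum_congr rfl fun i _ => hterm i]
  simp only [Finset.sum_add_distrib, Finset.sum_sub_distrib, ← Finset.sum_mul, ← Finset.mul_sum]
  rw [hcross, hLx, hQx, ← hlap, ← heq]
  simp
  ring

/-- Proposition 3.1 of the paper (Pohozaev identity, classical-solution form):
if `u` is a `C²` solution of `-Δu = g(u)` on `ℝ^N` with `∫ |∇u|² < ∞` and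
`G(u) ∈ L¹(ℝ^N)`, then `∫ |∇u|² = 2* ∫ G(u)` where `2* = 2N/(N-2)`. -/
theorem pohozaev_identity
    (N : ℕ) (hN : 3 ≤ N)
    (g G : ℝ → ℝ) (hg_cont : Continuous g)
    (hG : ∀ s : ℝ, G s = ∫ t in (0:ℝ)..s, g t)
    (u : EuclideanSpace ℝ (Fin N) → ℝ)
    (hu : ContDiff ℝ 2 u)
    (heq : ∀ x, -laplacian u x = g (u x))
    (hgrad : Integrable (fun x => ‖gradient u x‖ ^ 2))
    (hGu : Integrable (fun x => G (u x))) :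
    ∫ x, ‖gradient u x‖ ^ 2 = ((2 * N : ℝ) / (N - 2)) * ∫ x, G (u x) := by
  have hGd (s : ℝ) : HasDerivAt G (g s) s := by
    rw [funext hG]
    exact hg_cont.integral_hasStrictDerivAt 0 s |>.hasDerivAt
  have hG' : deriv G = g := funext fun s => (hGd s).deriv
  have hGd' : Differentiable ℝ G := fun s => (hGd s).differentiableAt
  have hG1 : ContDiff ℝ 1 G := contDiff_one_iff_deriv.2 ⟨hGd', hG' ▸ hg_cont⟩
  have hdiv (x) := sum_fderiv_pohozaevField hGd' hu x (by rw [hG', heq])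
  have h1 : Integrable fun x => (1 - N / 2 : ℝ) * ‖gradient u x‖ ^ 2 := hgrad.const_mul _
  have h2 : Integrable fun x => (N : ℝ) * G (u x) := hGu.const_mul _
  have key := integral_divergence_eq_zero_of_abs_le (contDiff_pohozaevField hG1 hu)
    ((hgrad.const_mul (3 / 2)).add hGu.abs) (abs_pohozaevField_le G u)
    (by simp_rw [hdiv]; exact h1.add h2)
  simp_rw [hdiv] at key
  rw [integral_add h1 h2, integral_const_mul, integral_const_mul] at key
  have hN' : (N : ℝ) - 2 ≠ 0 := by
    have : (3 : ℝ) ≤ N := by exact_mod_cast hN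
    linarith
  field_simp
  linear_combination -2 * key
end
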